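/- arXiv:2406.12884 — 3 statements merged into one kernel-verified Lean document; each statement's English description precedes it below -/
import Mathlib

section
/- Let $K$ be a field, $n\geq 4$, $2\leq j\leq n-1$, $0\neq\gamma\in K$, and let $a=\gamma y_1^{i_1}y_2^{i_2}\cdots y_n^{i_n}\in U$ be a monomial with $i_j\geq 1$. Set $u=y_1^{i_1}\cdots y_{j-1}^{i_{j-1}}y_j^{i_j-1}$ and $v=y_{j+1}^{i_{j+1}}\cdots y_n^{i_n}$, and consider the elementary automorphisms $\phi=(x_1,\ldots,x_{n-1},\ x_n+[x_2,x_3]u)$ and $\psi=(x_1-\gamma[x_j,x_n]v,\ x_2,\ldots,x_n)$ of $M_n$. Then the commutator $[\phi,\psi]=\phi\psi\phi^{-1}\psi^{-1}$ equals $C(a)=(x_1+[x_2,x_3]a,\ x_2,\ldots,x_n)$; in particular $C(a)$ is tame. -/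
noncomputable section

/-- The free metabelian Lie algebra of rank `n` over `K`: the quotient of the free Lie
algebra on `n` generators by its second derived ideal. -/
abbrev FreeMetabelianLie (K : Type) [Field K] (n : ℕ) : Type :=
  FreeLieAlgebra K (Fin n) ⧸ LieAlgebra.derivedSeries K (FreeLieAlgebra K (Fin n)) 2

/-- The free generators `x₁, …, xₙ` of the free metabelian Lie algebra. -/
def xg (K : Type) [Field K] (n : ℕ) (i : Fin n) : FreeMetabelianLie K n :=
  LieSubmodule.Quotient.mk (N := LieAlgebra.derivedSeries K (FreeLieAlgebra K (Fin n)) 2)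
    (FreeLieAlgebra.of K i)

/-- The group structure on Lie algebra automorphisms, with `(e * f) x = e (f x)`. -/
instance lieAutGroup (K : Type) [CommRing K] (L : Type) [LieRing L] [LieAlgebra K L] :
    Group (L ≃ₗ⁅K⁆ L) where
  mul e f := f.trans e
  one := LieEquiv.refl
  inv := LieEquiv.symm
  mul_assoc _ _ _ := LieEquiv.ext fun _ => rfl
  one_mul _ := LieEquiv.ext fun _ => rfl
  mul_one _ := LieEquiv.ext fun _ => rfl
  inv_mul_cancel e := LieEquiv.ext fun x => e.symm_apply_apply x

/-- An automorphism of the free metabelian Lie algebra is elementary if it maps some `xᵢ` to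
`α • xᵢ + f`, with `0 ≠ α ∈ K` and `f` in the subalgebra generated by the other generators,
and fixes all other generators. -/
def IsElementaryAut (K : Type) [Field K] (n : ℕ)
    (φ : FreeMetabelianLie K n ≃ₗ⁅K⁆ FreeMetabelianLie K n) : Prop :=
  ∃ (i : Fin n) (α : K) (f : FreeMetabelianLie K n), α ≠ 0 ∧
    f ∈ LieSubalgebra.lieSpan K (FreeMetabelianLie K n) (xg K n '' {j | j ≠ i}) ∧
    φ (xg K n i) = α • xg K n i + f ∧ ∀ j : Fin n, j ≠ i → φ (xg K n j) = xg K n j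

/-- A tame automorphism is one in the subgroup generated by the elementary automorphisms. -/
def IsTame (K : Type) [Field K] (n : ℕ)
    (φ : FreeMetabelianLie K n ≃ₗ⁅K⁆ FreeMetabelianLie K n) : Prop :=
  φ ∈ Subgroup.closure {ψ | IsElementaryAut K n ψ}

/-- A Chein automorphism (one-row transformation) moves only one generator. -/
def IsCheinAut (K : Type) [Field K] (n : ℕ)
    (φ : FreeMetabelianLie K n ≃ₗ⁅K⁆ FreeMetabelianLie K n) : Prop :=
  ∃ i : Fin n, ∀ j : Fin n, j ≠ i → φ (xg K n j) = xg K n j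

/-- An almost tame automorphism is one in the subgroup generated by Chein automorphisms. -/
def IsAlmostTame (K : Type) [Field K] (n : ℕ)
    (φ : FreeMetabelianLie K n ≃ₗ⁅K⁆ FreeMetabelianLie K n) : Prop :=
  φ ∈ Subgroup.closure {ψ | IsCheinAut K n ψ}

/-- `monoSet K n k` is the set of right-normed Lie monomials of degree `k+1` in the
generators. -/
def monoSet (K : Type) [Field K] (n : ℕ) : ℕ → Set (FreeMetabelianLie K n)
  | 0 => Set.range (xg K n)
  | k + 1 => {z | ∃ u ∈ monoSet K n k, ∃ i : Fin n, z = ⁅u, xg K n i⁆}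

/-- `gradePiece K n k` (for `k ≥ 1`) is the homogeneous component `L_k` of the standard
grading: the linear span of the Lie monomials of degree `k` in the generators. -/
def gradePiece (K : Type) [Field K] (n : ℕ) (k : ℕ) : Submodule K (FreeMetabelianLie K n) :=
  Submodule.span K (monoSet K n (k - 1))

/-- The automorphism `φ = (l₁ + m₁, …, lₙ + mₙ)` (with `lᵢ` linear, `mᵢ ∈ [M,M]`) has lower
degree `≥ d`: each `φ(xᵢ)` lies in `L₁ ⊕ (⨆ k ≥ d, L_k)`. -/
def AutLdegGE (K : Type) [Field K] (n : ℕ)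
    (φ : FreeMetabelianLie K n ≃ₗ⁅K⁆ FreeMetabelianLie K n) (d : ℕ) : Prop :=
  ∀ i : Fin n, φ (xg K n i) ∈
    gradePiece K n 1 ⊔ ⨆ (k : ℕ) (_ : d ≤ k), gradePiece K n k

/-- The action of a polynomial `a ∈ U = K[y₁,…,yₙ]` on `m`; for `m ∈ [M,M]` this is the
canonical `U`-module action on the derived ideal, determined by `m ⬝ yᵢ = ⁅m, xᵢ⁆`. -/
def polyAct (K : Type) [Field K] (n : ℕ) (a : MvPolynomial (Fin n) K)
    (m : FreeMetabelianLie K n) : FreeMetabelianLie K n :=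
  ∑ d ∈ a.support, a.coeff d •
    ((List.ofFn fun i : Fin n =>
      (-(LieAlgebra.ad K (FreeMetabelianLie K n) (xg K n i))) ^ (d i)).prod m)

/-- The polynomial `a` has lower degree `≥ d`: every monomial of `a` has total degree `≥ d`. -/
def PolyLdegGE (K : Type) [Field K] (n : ℕ) (a : MvPolynomial (Fin n) K) (d : ℕ) : Prop :=
  ∀ v ∈ a.support, d ≤ ∑ i, v i

/-- An exponential automorphism: `exp (ad z) = id + ad z` for some `z ∈ [M,M]`. -/
def IsExponentialAut (K : Type) [Field K] (n : ℕ)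
    (φ : FreeMetabelianLie K n ≃ₗ⁅K⁆ FreeMetabelianLie K n) : Prop :=
  ∃ z ∈ LieAlgebra.derivedSeries K (FreeMetabelianLie K n) 1,
    ∀ m : FreeMetabelianLie K n, φ m = m + ⁅z, m⁆

end

namespace FreeMetabelianLie

variable {K : Type} [Field K] {n : ℕ}

/-- The derived ideal of the free metabelian Lie algebra. -/
noncomputable abbrev derivedIdeal (K : Type) [Field K] (n : ℕ) :
    LieIdeal K (FreeMetabelianLie K n) :=
  LieAlgebra.derivedSeries K (FreeMetabelianLie K n) 1

/-- The quotient map from the free Lie algebra, as a morphism of Lie algebras. -/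
noncomputable def mkHom (K : Type) [Field K] (n : ℕ) :
    FreeLieAlgebra K (Fin n) →ₗ⁅K⁆ FreeMetabelianLie K n where
  toLinearMap := (LieSubmodule.Quotient.mk'
    (LieAlgebra.derivedSeries K (FreeLieAlgebra K (Fin n)) 2) : _ →ₗ[K] _)
  map_lie' := LieSubmodule.Quotient.mk_bracket _ _ _

theorem mkHom_surjective : Function.Surjective (mkHom K n) :=
  LieSubmodule.Quotient.surjective_mk' _

theorem equiv_ext {φ ψ : FreeMetabelianLie K n ≃ₗ⁅K⁆ FreeMetabelianLie K n}
    (h : ∀ i, φ (xg K n i) = ψ (xg K n i)) : φ = ψ := by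
  have key : φ.toLieHom.comp (mkHom K n) = ψ.toLieHom.comp (mkHom K n) :=
    FreeLieAlgebra.hom_ext fun i => h i
  ext m
  obtain ⟨m, rfl⟩ := mkHom_surjective m
  exact LieHom.congr_fun key m

theorem lie_mem_derivedIdeal (x y : FreeMetabelianLie K n) : ⁅x, y⁆ ∈ derivedIdeal K n :=
  LieSubmodule.lie_mem_lie (LieSubmodule.mem_top x) (LieSubmodule.mem_top y)

theorem derivedSeries_two_eq_bot :
    LieAlgebra.derivedSeries K (FreeMetabelianLie K n) 2 = ⊥ := by
  rw [← LieIdeal.derivedSeries_map_eq 2 (mkHom_surjective (K := K) (n := n)),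
    LieIdeal.map_eq_bot_iff]
  intro m hm
  exact (LieSubmodule.Quotient.mk_eq_zero (N := LieAlgebra.derivedSeries K _ 2)).2 hm

theorem lie_eq_zero_of_mem {z w : FreeMetabelianLie K n} (hz : z ∈ derivedIdeal K n)
    (hw : w ∈ derivedIdeal K n) : ⁅z, w⁆ = 0 := by
  have h : ⁅z, w⁆ ∈ LieAlgebra.derivedSeries K (FreeMetabelianLie K n) 2 :=
    LieSubmodule.lie_mem_lie hz hw
  rwa [derivedSeries_two_eq_bot, LieSubmodule.mem_bot] at h

theorem equiv_mem_derivedIdeal (θ : FreeMetabelianLie K n ≃ₗ⁅K⁆ FreeMetabelianLie K n)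
    {m : FreeMetabelianLie K n} (hm : m ∈ derivedIdeal K n) : θ m ∈ derivedIdeal K n := by
  have h := LieIdeal.derivedSeries_map_eq (f := θ.toLieHom) 1 θ.surjective
  exact h.le (LieIdeal.mem_map hm)

/-- The action of the variable `yᵢ` on the derived ideal. -/
noncomputable def genAct (K : Type) [Field K] (n : ℕ) (i : Fin n) :
    Module.End K (derivedIdeal K n) :=
  -LieModule.toEnd K (FreeMetabelianLie K n) (derivedIdeal K n) (xg K n i)

theorem coe_genAct (i : Fin n) (m : derivedIdeal K n) :
    (genAct K n i m : FreeMetabelianLie K n) = ⁅(m : FreeMetabelianLie K n), xg K n i⁆ := by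
  simp [genAct]

theorem genAct_commute (i j : Fin n) :
    genAct K n i * genAct K n j = genAct K n j * genAct K n i := by
  ext m
  simp only [Module.End.mul_apply, coe_genAct]
  have h := lie_eq_zero_of_mem m.2 (lie_mem_derivedIdeal (xg K n j) (xg K n i))
  rw [leibniz_lie, ← lie_skew (xg K n j)] at h
  rwa [← sub_eq_add_neg, sub_eq_zero] at h

theorem coe_list_prod_genAct (d : Fin n → ℕ) (l : List (Fin n)) (m : derivedIdeal K n) :
    ((l.map fun i => genAct K n i ^ d i).prod m : FreeMetabelianLie K n) =
      (l.map fun i => (-(LieAlgebra.ad K (FreeMetabelianLie K n) (xg K n i))) ^ d i).prod m := by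
  have hpow (i : Fin n) (k : ℕ) (m : derivedIdeal K n) :
      ((genAct K n i ^ k) m : FreeMetabelianLie K n) =
        ((-(LieAlgebra.ad K (FreeMetabelianLie K n) (xg K n i))) ^ k) m := by
    induction k with
    | zero => rfl
    | succ k ih =>
      rw [pow_succ', pow_succ', Module.End.mul_apply, Module.End.mul_apply, coe_genAct, ih]
      simp
  induction l with
  | nil => rfl
  | cons i l ih =>
    simp only [List.map_cons, List.prod_cons, Module.End.mul_apply]
    rw [hpow, ih]

open scoped IsMulCommutative in
theorem exists_polyAct_algHom (K : Type) [Field K] (n : ℕ) :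
    ∃ F : MvPolynomial (Fin n) K →ₐ[K] Module.End K (derivedIdeal K n),
      (∀ i, F (MvPolynomial.X i) = genAct K n i) ∧
      ∀ a m, (F a m : FreeMetabelianLie K n) = polyAct K n a m := by
  obtain ⟨S, hS, hmem⟩ : ∃ S : Subalgebra K (Module.End K (derivedIdeal K n)),
      IsMulCommutative S ∧ ∀ i, genAct K n i ∈ S := by
    refine ⟨Algebra.adjoin K (Set.range (genAct K n)), Algebra.isMulCommutative_adjoin K ?_,
      fun i => Algebra.subset_adjoin ⟨i, rfl⟩⟩
    rintro _ ⟨i, rfl⟩ _ ⟨j, rfl⟩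
    exact genAct_commute i j
  let b (i : Fin n) : S := ⟨genAct K n i, hmem i⟩
  let F : MvPolynomial (Fin n) K →ₐ[K] Module.End K (derivedIdeal K n) :=
    S.val.comp (MvPolynomial.aeval b)
  refine ⟨F, fun i => by simp [F, b], fun a m => ?_⟩
  have h : F a = ∑ d ∈ a.support, a.coeff d •
      (List.ofFn fun i : Fin n => genAct K n i ^ d i).prod := by
    simp only [F, AlgHom.comp_apply, MvPolynomial.aeval_def, MvPolynomial.eval₂_eq', map_sum]
    refine Finset.sum_congr rfl fun d _ => ?_
    rw [← Algebra.smul_def, map_smul, ← List.prod_ofFn, map_list_prod, List.map_ofFn]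
    rfl
  rw [h, polyAct, LinearMap.sum_apply, AddSubmonoidClass.coe_finsetSum]
  refine Finset.sum_congr rfl fun d _ => ?_
  rw [LinearMap.smul_apply, LieSubmodule.coe_smul, List.ofFn_eq_map, List.ofFn_eq_map,
    coe_list_prod_genAct]

section PolyAct

open MvPolynomial

variable {m : FreeMetabelianLie K n}

theorem polyAct_mem (a : MvPolynomial (Fin n) K) (hm : m ∈ derivedIdeal K n) :
    polyAct K n a m ∈ derivedIdeal K n := by
  obtain ⟨F, -, hF⟩ := exists_polyAct_algHom K n
  exact hF a ⟨m, hm⟩ ▸ (F a ⟨m, hm⟩).2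

theorem polyAct_mul (a b : MvPolynomial (Fin n) K) (hm : m ∈ derivedIdeal K n) :
    polyAct K n (a * b) m = polyAct K n a (polyAct K n b m) := by
  obtain ⟨F, -, hF⟩ := exists_polyAct_algHom K n
  rw [← hF b ⟨m, hm⟩, ← hF, ← hF (a * b) ⟨m, hm⟩, map_mul, Module.End.mul_apply]

theorem polyAct_X (i : Fin n) (hm : m ∈ derivedIdeal K n) :
    polyAct K n (X i) m = ⁅m, xg K n i⁆ := by
  obtain ⟨F, hX, hF⟩ := exists_polyAct_algHom K n
  rw [← hF (X i) ⟨m, hm⟩, hX, coe_genAct]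

theorem polyAct_C (c : K) (hm : m ∈ derivedIdeal K n) : polyAct K n (C c) m = c • m := by
  obtain ⟨F, -, hF⟩ := exists_polyAct_algHom K n
  rw [← hF (C c) ⟨m, hm⟩, ← algebraMap_eq, AlgHom.commutes]
  rfl

theorem polyAct_add_left (a b : MvPolynomial (Fin n) K) (hm : m ∈ derivedIdeal K n) :
    polyAct K n (a + b) m = polyAct K n a m + polyAct K n b m := by
  obtain ⟨F, -, hF⟩ := exists_polyAct_algHom K n
  rw [← hF _ ⟨m, hm⟩, ← hF _ ⟨m, hm⟩, ← hF _ ⟨m, hm⟩, map_add]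
  rfl

theorem polyAct_add_right (a : MvPolynomial (Fin n) K) (m m' : FreeMetabelianLie K n) :
    polyAct K n a (m + m') = polyAct K n a m + polyAct K n a m' := by
  simp only [polyAct, map_add, smul_add, Finset.sum_add_distrib]

theorem polyAct_neg (a : MvPolynomial (Fin n) K) (m : FreeMetabelianLie K n) :
    polyAct K n a (-m) = -polyAct K n a m := by
  simp only [polyAct, map_neg, smul_neg, Finset.sum_neg_distrib]

/-- An automorphism that is trivial modulo the derived ideal is linear over the polynomial
ring on the derived ideal. -/
theorem map_polyAct {θ : FreeMetabelianLie K n ≃ₗ⁅K⁆ FreeMetabelianLie K n}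
    (hθ : ∀ i, θ (xg K n i) - xg K n i ∈ derivedIdeal K n) (a : MvPolynomial (Fin n) K)
    (hm : m ∈ derivedIdeal K n) : θ (polyAct K n a m) = polyAct K n a (θ m) := by
  induction a using MvPolynomial.induction_on generalizing m with
  | C c => rw [polyAct_C c hm, polyAct_C c (equiv_mem_derivedIdeal θ hm), map_smul]
  | add a b ha hb =>
    rw [polyAct_add_left a b hm, polyAct_add_left a b (equiv_mem_derivedIdeal θ hm), map_add,
      ha hm, hb hm]
  | mul_X a i ha =>
    have h := lie_eq_zero_of_mem (equiv_mem_derivedIdeal θ hm) (hθ i)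
    rw [lie_sub, sub_eq_zero] at h
    rw [polyAct_mul _ _ hm, polyAct_mul _ _ (equiv_mem_derivedIdeal θ hm),
      ha (polyAct_mem _ hm), polyAct_X i hm, polyAct_X i (equiv_mem_derivedIdeal θ hm),
      LieEquiv.map_lie, h]

theorem polyAct_X_pow_mem {S : LieSubalgebra K (FreeMetabelianLie K n)} {i : Fin n}
    (hi : xg K n i ∈ S) (k : ℕ) (hm : m ∈ derivedIdeal K n) (hS : m ∈ S) :
    polyAct K n (X i ^ k) m ∈ S := by
  induction k with
  | zero => rwa [pow_zero, ← C_1, polyAct_C _ hm, one_smul]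
  | succ k ih =>
    rw [pow_succ', polyAct_mul _ _ hm, polyAct_X _ (polyAct_mem _ hm)]
    exact S.lie_mem ih hi

theorem polyAct_prod_X_pow_mem {S : LieSubalgebra K (FreeMetabelianLie K n)}
    (s : Finset (Fin n)) (e : Fin n → ℕ) (hs : ∀ i ∈ s, xg K n i ∈ S)
    (hm : m ∈ derivedIdeal K n) (hS : m ∈ S) :
    polyAct K n (∏ i ∈ s, X i ^ e i) m ∈ S := by
  induction s using Finset.induction_on with
  | empty => rwa [Finset.prod_empty, ← C_1, polyAct_C _ hm, one_smul]
  | insert i s hi ih =>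
    rw [Finset.prod_insert hi, polyAct_mul _ _ hm]
    exact polyAct_X_pow_mem (hs i (Finset.mem_insert_self i s)) _ (polyAct_mem _ hm)
      (ih fun j hj => hs j (Finset.mem_insert_of_mem hj))

end PolyAct

theorem sub_mem_derivedIdeal_of_forall_ne {i : Fin n}
    {θ : FreeMetabelianLie K n ≃ₗ⁅K⁆ FreeMetabelianLie K n}
    (hi : θ (xg K n i) - xg K n i ∈ derivedIdeal K n)
    (h : ∀ j, j ≠ i → θ (xg K n j) = xg K n j) (j : Fin n) :
    θ (xg K n j) - xg K n j ∈ derivedIdeal K n := by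
  by_cases hj : j = i
  · rwa [hj]
  · rw [h j hj, sub_self]
    exact zero_mem _

theorem prod_X_pow_split (e : Fin n → ℕ) (j : Fin n) (hj : 1 ≤ e j) :
    (∏ i, MvPolynomial.X i ^ e i : MvPolynomial (Fin n) K) =
      (∏ i ∈ Finset.univ.filter (fun i => j < i), MvPolynomial.X i ^ e i) * (MvPolynomial.X j *
        ((∏ i ∈ Finset.univ.filter (fun i => i < j), MvPolynomial.X i ^ e i) *
          MvPolynomial.X j ^ (e j - 1))) := by
  have h : (Finset.univ.filter fun i => ¬ i < j) =
      insert j (Finset.univ.filter fun i => j < i) := by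
    ext i
    simp [le_iff_eq_or_lt, eq_comm]
  rw [← Finset.prod_filter_mul_prod_filter_not Finset.univ (fun i => i < j), h,
    Finset.prod_insert (by simp), ← Nat.sub_add_cancel hj, pow_succ, Nat.add_sub_cancel]
  ring

end FreeMetabelianLie

open FreeMetabelianLie

open MvPolynomial in
/-- **Case 1 of Theorem 1.** For a monomial `a = γ y₁^{i₁} ⋯ yₙ^{iₙ}` with `i_j ≥ 1` for
some `2 ≤ j ≤ n-1`, with `u = y₁^{i₁} ⋯ y_j^{i_j - 1}` and `v = y_{j+1}^{i_{j+1}} ⋯ yₙ^{iₙ}`,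
the elementary automorphisms `φ = (x₁, …, x_{n-1}, xₙ + [x₂,x₃]u)` and
`ψ = (x₁ - γ[x_j,xₙ]v, x₂, …, xₙ)` satisfy `[φ,ψ] = C(a) = (x₁ + [x₂,x₃]a, x₂, …, xₙ)`;
in particular `C(a)` is tame. -/
theorem commutator_eq_chein_C_a (K : Type) [Field K] (n : ℕ) (hn : 4 ≤ n)
    (γ : K) (hγ : γ ≠ 0) (e : Fin n → ℕ)
    (i0 i1 i2 iN jj : Fin n)
    (h0 : (i0 : ℕ) = 0) (h1 : (i1 : ℕ) = 1) (h2 : (i2 : ℕ) = 2) (hN : (iN : ℕ) = n - 1)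
    (hj1 : 1 ≤ (jj : ℕ)) (hj2 : (jj : ℕ) ≤ n - 2) (hej : 1 ≤ e jj)
    (φ ψ χ : FreeMetabelianLie K n ≃ₗ⁅K⁆ FreeMetabelianLie K n)
    (hφN : φ (xg K n iN) = xg K n iN +
      polyAct K n ((∏ i ∈ Finset.univ.filter (fun i => i < jj), X i ^ e i) * X jj ^ (e jj - 1))
        ⁅xg K n i1, xg K n i2⁆)
    (hφ : ∀ j : Fin n, j ≠ iN → φ (xg K n j) = xg K n j)
    (hψ0 : ψ (xg K n i0) = xg K n i0 -
      polyAct K n (C γ * ∏ i ∈ Finset.univ.filter (fun i => jj < i), X i ^ e i)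
        ⁅xg K n jj, xg K n iN⁆)
    (hψ : ∀ j : Fin n, j ≠ i0 → ψ (xg K n j) = xg K n j)
    (hχ0 : χ (xg K n i0) = xg K n i0 +
      polyAct K n (C γ * ∏ i, X i ^ e i) ⁅xg K n i1, xg K n i2⁆)
    (hχ : ∀ j : Fin n, j ≠ i0 → χ (xg K n j) = xg K n j) :
    φ * ψ * φ⁻¹ * ψ⁻¹ = χ ∧ IsTame K n χ := by
  have n0N : i0 ≠ iN := fun h => by simp only [Fin.ext_iff] at h; omega
  have n1N : i1 ≠ iN := fun h => by simp only [Fin.ext_iff] at h; omega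
  have n2N : i2 ≠ iN := fun h => by simp only [Fin.ext_iff] at h; omega
  have n10 : i1 ≠ i0 := fun h => by simp only [Fin.ext_iff] at h; omega
  have n20 : i2 ≠ i0 := fun h => by simp only [Fin.ext_iff] at h; omega
  have nj0 : jj ≠ i0 := fun h => by simp only [Fin.ext_iff] at h; omega
  have njN : jj ≠ iN := fun h => by simp only [Fin.ext_iff] at h; omega
  have hw := lie_mem_derivedIdeal (xg K n i1) (xg K n i2)
  have hz := lie_mem_derivedIdeal (xg K n jj) (xg K n iN)
  have hmφ : ∀ i, φ (xg K n i) - xg K n i ∈ derivedIdeal K n :=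
    sub_mem_derivedIdeal_of_forall_ne
      (by rw [hφN, add_sub_cancel_left]; exact polyAct_mem _ hw) hφ
  have hmψ : ∀ i, ψ (xg K n i) - xg K n i ∈ derivedIdeal K n :=
    sub_mem_derivedIdeal_of_forall_ne
      (by rw [hψ0, sub_sub_cancel_left]; exact neg_mem (polyAct_mem _ hz)) hψ
  have hmχ : ∀ i, χ (xg K n i) - xg K n i ∈ derivedIdeal K n :=
    sub_mem_derivedIdeal_of_forall_ne
      (by rw [hχ0, add_sub_cancel_left]; exact polyAct_mem _ hw) hχ
  have hcomm : φ * ψ = χ * ψ * φ := by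
    refine equiv_ext fun i => ?_
    change φ (ψ (xg K n i)) = χ (ψ (φ (xg K n i)))
    by_cases hi0 : i = i0
    · subst hi0
      rw [hφ _ n0N, hψ0, map_sub, map_sub, map_polyAct hmφ _ hz, map_polyAct hmχ _ hz,
        hφ _ n0N, hχ0, LieEquiv.map_lie, LieEquiv.map_lie, hφ _ njN, hφN, hχ _ nj0,
        hχ _ n0N.symm, lie_add, polyAct_add_right, prod_X_pow_split e jj hej, ← mul_assoc,
        polyAct_mul _ (X jj * _) hw, polyAct_mul (X jj) _ hw, polyAct_X _ (polyAct_mem _ hw),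
        ← lie_skew (xg K n jj) (polyAct K n _ _), polyAct_neg]
      abel
    · by_cases hiN : i = iN
      · subst hiN
        rw [hψ _ hi0, hφN, map_add, map_add, map_polyAct hmψ _ hw, LieEquiv.map_lie,
          hψ _ hi0, hψ _ n10, hψ _ n20, map_polyAct hmχ _ hw, LieEquiv.map_lie,
          hχ _ hi0, hχ _ n10, hχ _ n20]
      · rw [hψ _ hi0, hφ _ hiN, hψ _ hi0, hχ _ hi0]
  have heq : φ * ψ * φ⁻¹ * ψ⁻¹ = χ := by
    rw [hcomm]
    group
  have hgen {i j : Fin n} (h : j ≠ i) : xg K n j ∈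
      LieSubalgebra.lieSpan K (FreeMetabelianLie K n) (xg K n '' {j | j ≠ i}) :=
    LieSubalgebra.subset_lieSpan ⟨j, h, rfl⟩
  have hφE : φ ∈ Subgroup.closure {ψ | IsElementaryAut K n ψ} := by
    refine Subgroup.subset_closure ⟨iN, 1, _, one_ne_zero, ?_, by rw [one_smul, hφN], hφ⟩
    rw [polyAct_mul _ _ hw]
    refine polyAct_prod_X_pow_mem _ _ (fun i hi => hgen ?_) (polyAct_mem _ hw)
      (polyAct_X_pow_mem (hgen njN) _ hw (LieSubalgebra.lie_mem _ (hgen n1N) (hgen n2N)))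
    rintro rfl
    have := Fin.lt_def.1 (Finset.mem_filter.1 hi).2
    omega
  have hψE : ψ ∈ Subgroup.closure {ψ | IsElementaryAut K n ψ} := by
    refine Subgroup.subset_closure ⟨i0, 1, _, one_ne_zero, ?_,
      by rw [one_smul, hψ0, sub_eq_add_neg], hψ⟩
    rw [polyAct_mul _ _ hz, polyAct_C _ (polyAct_mem _ hz)]
    refine neg_mem (SMulMemClass.smul_mem _ (polyAct_prod_X_pow_mem _ _ (fun i hi => hgen ?_) hz
      (LieSubalgebra.lie_mem _ (hgen nj0) (hgen n0N.symm))))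
    rintro rfl
    have := Fin.lt_def.1 (Finset.mem_filter.1 hi).2
    omega
  refine ⟨heq, ?_⟩
  rw [IsTame, ← heq]
  exact mul_mem (mul_mem (mul_mem hφE hψE) (inv_mem hφE)) (inv_mem hψE)
end

section
/- Let $K$ be any field, $n\geq 4$, $0\neq\gamma\in K$, and let $i_1\geq 1$ and $i_n\geq 2$ be integers. Then the Chein automorphism $C(\gamma y_1^{i_1}y_n^{i_n})=(x_1+[x_2,x_3]\gamma y_1^{i_1}y_n^{i_n},\ x_2,\ldots,x_n)$ of $M_n$ is tame. -/
namespace FreeMetabelianLie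

variable {K : Type} [Field K] {n : ℕ}

/-- The canonical projection from the free Lie algebra, as a morphism of Lie algebras. -/
noncomputable def proj (K : Type) [Field K] (n : ℕ) :
    FreeLieAlgebra K (Fin n) →ₗ⁅K⁆ FreeMetabelianLie K n where
  toFun := LieSubmodule.Quotient.mk
  map_add' _ _ := rfl
  map_smul' _ _ := rfl
  map_lie' := rfl

theorem proj_surjective : Function.Surjective (proj K n) := Quot.mk_surjective

theorem lie_mem_derivedSeries_one (a b : FreeMetabelianLie K n) :
    ⁅a, b⁆ ∈ LieAlgebra.derivedSeries K (FreeMetabelianLie K n) 1 :=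
  LieSubmodule.lie_mem_lie (LieSubmodule.mem_top a) (LieSubmodule.mem_top b)

theorem lie_eq_zero {a b : FreeMetabelianLie K n}
    (ha : a ∈ LieAlgebra.derivedSeries K (FreeMetabelianLie K n) 1)
    (hb : b ∈ LieAlgebra.derivedSeries K (FreeMetabelianLie K n) 1) : ⁅a, b⁆ = 0 := by
  have h : ⁅a, b⁆ ∈ LieAlgebra.derivedSeries K (FreeMetabelianLie K n) 2 :=
    LieSubmodule.lie_mem_lie ha hb
  rwa [derivedSeries_two_eq_bot, LieSubmodule.mem_bot] at h

/-- The endomorphism of the free metabelian Lie algebra with prescribed values on generators. -/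
noncomputable def liftEnd (f : Fin n → FreeMetabelianLie K n) :
    FreeMetabelianLie K n →ₗ⁅K⁆ FreeMetabelianLie K n :=
  have hf : (LieAlgebra.derivedSeries K (FreeLieAlgebra K (Fin n)) 2).toSubmodule ≤
      LinearMap.ker (FreeLieAlgebra.lift K f : FreeLieAlgebra K (Fin n) →ₗ[K] _) := by
    intro x hx
    have h := LieIdeal.derivedSeries_map_le (f := FreeLieAlgebra.lift K f) 2
      (LieIdeal.mem_map hx)
    rw [derivedSeries_two_eq_bot, LieSubmodule.mem_bot] at h
    exact h
  { Submodule.liftQ _ (FreeLieAlgebra.lift K f : FreeLieAlgebra K (Fin n) →ₗ[K] _) hf with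
    map_lie' := by
      intro x y
      obtain ⟨x, rfl⟩ := proj_surjective x
      obtain ⟨y, rfl⟩ := proj_surjective y
      exact (FreeLieAlgebra.lift K f).map_lie x y }

@[simp]
theorem liftEnd_xg (f : Fin n → FreeMetabelianLie K n) (i : Fin n) :
    liftEnd f (xg K n i) = f i :=
  FreeLieAlgebra.lift_of_apply f i

theorem hom_ext {L : Type} [LieRing L] [LieAlgebra K L] {f g : FreeMetabelianLie K n →ₗ⁅K⁆ L}
    (h : ∀ i, f (xg K n i) = g (xg K n i)) : f = g := by
  have h' : f.comp (proj K n) = g.comp (proj K n) := FreeLieAlgebra.hom_ext h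
  ext x
  obtain ⟨x, rfl⟩ := proj_surjective x
  exact LieHom.congr_fun h' x

/-- Right multiplication by the generator `xᵢ`, so that `actVar i m = ⁅m, xᵢ⁆`. -/
noncomputable abbrev actVar (i : Fin n) : Module.End K (FreeMetabelianLie K n) :=
  -(LieAlgebra.ad K (FreeMetabelianLie K n) (xg K n i))

theorem actVar_apply (i : Fin n) (m : FreeMetabelianLie K n) :
    actVar i m = ⁅m, xg K n i⁆ := by
  simp [actVar]

theorem actVar_mem (i : Fin n) (m : FreeMetabelianLie K n) :
    actVar i m ∈ LieAlgebra.derivedSeries K (FreeMetabelianLie K n) 1 := by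
  rw [actVar_apply]
  exact lie_mem_derivedSeries_one _ _

theorem actVar_pow_mem (i : Fin n) (a : ℕ) {m : FreeMetabelianLie K n}
    (hm : m ∈ LieAlgebra.derivedSeries K (FreeMetabelianLie K n) 1) :
    (actVar i ^ a) m ∈ LieAlgebra.derivedSeries K (FreeMetabelianLie K n) 1 := by
  induction a with
  | zero => simpa using hm
  | succ a ih =>
    rw [pow_succ', Module.End.mul_apply]
    exact actVar_mem _ _

theorem actVar_comm (i j : Fin n) {m : FreeMetabelianLie K n}
    (hm : m ∈ LieAlgebra.derivedSeries K (FreeMetabelianLie K n) 1) :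
    actVar i (actVar j m) = actVar j (actVar i m) := by
  simp only [actVar_apply]
  rw [← sub_eq_zero, ← lie_eq_zero hm (lie_mem_derivedSeries_one (xg K n j) (xg K n i)),
    leibniz_lie m, ← lie_skew (xg K n j) ⁅m, xg K n i⁆, sub_eq_add_neg]

theorem actVar_pow_comm (i j : Fin n) (a : ℕ) {m : FreeMetabelianLie K n}
    (hm : m ∈ LieAlgebra.derivedSeries K (FreeMetabelianLie K n) 1) :
    (actVar i ^ a) (actVar j m) = actVar j ((actVar i ^ a) m) := by
  induction a with
  | zero => simp
  | succ a ih =>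
    rw [pow_succ', Module.End.mul_apply, Module.End.mul_apply, ih,
      actVar_comm i j (actVar_pow_mem i a hm)]

theorem actVar_pow_pow_comm (i j : Fin n) (a b : ℕ) {m : FreeMetabelianLie K n}
    (hm : m ∈ LieAlgebra.derivedSeries K (FreeMetabelianLie K n) 1) :
    (actVar i ^ a) ((actVar j ^ b) m) = (actVar j ^ b) ((actVar i ^ a) m) := by
  induction b with
  | zero => simp
  | succ b ih =>
    rw [pow_succ', Module.End.mul_apply, Module.End.mul_apply,
      actVar_pow_comm i j a (actVar_pow_mem j b hm), ih]

/-- An endomorphism inducing the identity modulo the derived ideal commutes with the action of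
the generators on the derived ideal. -/
theorem map_actVar {θ : FreeMetabelianLie K n →ₗ⁅K⁆ FreeMetabelianLie K n} {j : Fin n}
    (hθ : θ (xg K n j) - xg K n j ∈ LieAlgebra.derivedSeries K (FreeMetabelianLie K n) 1)
    {m : FreeMetabelianLie K n}
    (hm : m ∈ LieAlgebra.derivedSeries K (FreeMetabelianLie K n) 1) :
    θ (actVar j m) = actVar j (θ m) := by
  have hθm : θ m ∈ LieAlgebra.derivedSeries K (FreeMetabelianLie K n) 1 :=
    LieIdeal.derivedSeries_map_le (f := θ) 1 (LieIdeal.mem_map hm)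
  rw [actVar_apply, actVar_apply, LieHom.map_lie, ← sub_eq_zero, ← lie_sub]
  exact lie_eq_zero hθm hθ

theorem map_actVar_pow {θ : FreeMetabelianLie K n →ₗ⁅K⁆ FreeMetabelianLie K n} {j : Fin n}
    (hθ : θ (xg K n j) - xg K n j ∈ LieAlgebra.derivedSeries K (FreeMetabelianLie K n) 1)
    (a : ℕ) {m : FreeMetabelianLie K n}
    (hm : m ∈ LieAlgebra.derivedSeries K (FreeMetabelianLie K n) 1) :
    θ ((actVar j ^ a) m) = (actVar j ^ a) (θ m) := by
  induction a with
  | zero => simp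
  | succ a ih =>
    rw [pow_succ', Module.End.mul_apply, Module.End.mul_apply,
      map_actVar hθ (actVar_pow_mem j a hm), ih]

theorem actVar_mem_lieSpan {s : Set (Fin n)} {j : Fin n} (hj : j ∈ s)
    {m : FreeMetabelianLie K n}
    (hm : m ∈ LieSubalgebra.lieSpan K (FreeMetabelianLie K n) (xg K n '' s)) :
    actVar j m ∈ LieSubalgebra.lieSpan K (FreeMetabelianLie K n) (xg K n '' s) := by
  rw [actVar_apply]
  exact LieSubalgebra.lie_mem _ hm (LieSubalgebra.subset_lieSpan ⟨j, hj, rfl⟩)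

theorem actVar_pow_mem_lieSpan {s : Set (Fin n)} {j : Fin n} (hj : j ∈ s) (a : ℕ)
    {m : FreeMetabelianLie K n}
    (hm : m ∈ LieSubalgebra.lieSpan K (FreeMetabelianLie K n) (xg K n '' s)) :
    (actVar j ^ a) m ∈ LieSubalgebra.lieSpan K (FreeMetabelianLie K n) (xg K n '' s) := by
  induction a with
  | zero => simpa using hm
  | succ a ih =>
    rw [pow_succ', Module.End.mul_apply]
    exact actVar_mem_lieSpan hj ih

theorem lie_xg_mem_lieSpan {s : Set (Fin n)} {j k : Fin n} (hj : j ∈ s) (hk : k ∈ s) :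
    ⁅xg K n j, xg K n k⁆ ∈ LieSubalgebra.lieSpan K (FreeMetabelianLie K n) (xg K n '' s) :=
  LieSubalgebra.lie_mem _ (LieSubalgebra.subset_lieSpan ⟨j, hj, rfl⟩)
    (LieSubalgebra.subset_lieSpan ⟨k, hk, rfl⟩)

theorem map_eq_self_of_mem_lieSpan {L : Type} [LieRing L] [LieAlgebra K L] {s : Set L}
    {θ : L →ₗ⁅K⁆ L} (hθ : ∀ x ∈ s, θ x = x) {m : L} (hm : m ∈ LieSubalgebra.lieSpan K L s) :
    θ m = m := by
  induction hm using LieSubalgebra.lieSpan_induction with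
  | mem x hx => exact hθ x hx
  | zero => exact θ.map_zero
  | add x y _ _ hx hy => rw [map_add, hx, hy]
  | smul a x _ hx => rw [map_smul, hx]
  | lie x y _ _ hx hy => rw [LieHom.map_lie, hx, hy]

/-- The endomorphism `xᵢ ↦ xᵢ + f` fixing the other generators. -/
noncomputable def transvectionEnd (i : Fin n) (f : FreeMetabelianLie K n) :
    FreeMetabelianLie K n →ₗ⁅K⁆ FreeMetabelianLie K n :=
  liftEnd (Function.update (xg K n) i (xg K n i + f))

theorem transvectionEnd_self (i : Fin n) (f : FreeMetabelianLie K n) :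
    transvectionEnd i f (xg K n i) = xg K n i + f := by
  simp [transvectionEnd]

theorem transvectionEnd_of_ne {i j : Fin n} (hj : j ≠ i) (f : FreeMetabelianLie K n) :
    transvectionEnd i f (xg K n j) = xg K n j := by
  simp [transvectionEnd, hj]

theorem transvectionEnd_of_mem_lieSpan {i : Fin n} (f : FreeMetabelianLie K n)
    {m : FreeMetabelianLie K n}
    (hm : m ∈ LieSubalgebra.lieSpan K (FreeMetabelianLie K n) (xg K n '' {j | j ≠ i})) :
    transvectionEnd i f m = m := by
  refine map_eq_self_of_mem_lieSpan ?_ hm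
  rintro _ ⟨j, hj, rfl⟩
  exact transvectionEnd_of_ne hj f

theorem transvectionEnd_neg_comp {i : Fin n} {f : FreeMetabelianLie K n}
    (hf : f ∈ LieSubalgebra.lieSpan K (FreeMetabelianLie K n) (xg K n '' {j | j ≠ i})) :
    (transvectionEnd i (-f)).comp (transvectionEnd i f) = LieHom.id := by
  refine hom_ext fun j => ?_
  rw [LieHom.comp_apply, LieHom.id_apply]
  by_cases hj : j = i
  · subst hj
    rw [transvectionEnd_self, map_add, transvectionEnd_self,
      transvectionEnd_of_mem_lieSpan _ hf, neg_add_cancel_right]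
  · rw [transvectionEnd_of_ne hj, transvectionEnd_of_ne hj]

/-- The elementary automorphism `xᵢ ↦ xᵢ + f`, where `f` does not involve `xᵢ`. -/
noncomputable def transvection (i : Fin n) (f : FreeMetabelianLie K n)
    (hf : f ∈ LieSubalgebra.lieSpan K (FreeMetabelianLie K n) (xg K n '' {j | j ≠ i})) :
    FreeMetabelianLie K n ≃ₗ⁅K⁆ FreeMetabelianLie K n :=
  { transvectionEnd i f with
    invFun := transvectionEnd i (-f)
    left_inv := LieHom.congr_fun (transvectionEnd_neg_comp hf)
    right_inv := fun x => by
      have h := transvectionEnd_neg_comp (neg_mem hf)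
      rw [neg_neg] at h
      exact LieHom.congr_fun h x }

theorem isTame_transvection {i : Fin n} {f : FreeMetabelianLie K n}
    (hf : f ∈ LieSubalgebra.lieSpan K (FreeMetabelianLie K n) (xg K n '' {j | j ≠ i})) :
    IsTame K n (transvection i f hf) :=
  Subgroup.subset_closure ⟨i, 1, f, one_ne_zero, hf,
    by rw [one_smul]; exact transvectionEnd_self i f, fun _ hj => transvectionEnd_of_ne hj f⟩

theorem transvectionEnd_sub_mem (i j : Fin n) {f : FreeMetabelianLie K n}
    (hf : f ∈ LieAlgebra.derivedSeries K (FreeMetabelianLie K n) 1) :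
    transvectionEnd i f (xg K n j) - xg K n j ∈
      LieAlgebra.derivedSeries K (FreeMetabelianLie K n) 1 := by
  by_cases hj : j = i
  · subst hj
    rwa [transvectionEnd_self, add_sub_cancel_left]
  · rw [transvectionEnd_of_ne hj, sub_self]
    exact zero_mem _

/-- Commutators of elementary automorphisms moving `xₚ` and `xᵢ` give Chein automorphisms. -/
theorem exists_isTame_chein {i p j k : Fin n} (hip : i ≠ p) (hij : i ≠ j) (hik : i ≠ k)
    (hpj : p ≠ j) (hpk : p ≠ k) (c : K) (a b : ℕ) :
    ∃ ψ : FreeMetabelianLie K n ≃ₗ⁅K⁆ FreeMetabelianLie K n, IsTame K n ψ ∧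
      ψ (xg K n i) = xg K n i +
        c • (actVar i ^ a) ((actVar k ^ (b + 1)) (actVar p ⁅xg K n j, xg K n k⁆)) ∧
      ∀ l, l ≠ i → ψ (xg K n l) = xg K n l := by
  set w := (actVar i ^ a) ⁅xg K n j, xg K n k⁆ with hw
  have hwN : w ∈ LieAlgebra.derivedSeries K (FreeMetabelianLie K n) 1 :=
    actVar_pow_mem i a (lie_mem_derivedSeries_one _ _)
  set u := c • w with hu
  have huN : u ∈ LieAlgebra.derivedSeries K (FreeMetabelianLie K n) 1 :=
    Submodule.smul_mem _ c hwN
  set z := ⁅xg K n p, xg K n k⁆ with hz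
  have hzN : z ∈ LieAlgebra.derivedSeries K (FreeMetabelianLie K n) 1 :=
    lie_mem_derivedSeries_one _ _
  set v := (actVar k ^ b) (actVar p z) with hv
  have hvN : v ∈ LieAlgebra.derivedSeries K (FreeMetabelianLie K n) 1 :=
    actVar_pow_mem k b (actVar_mem p z)
  have hu_span : u ∈ LieSubalgebra.lieSpan K _ (xg K n '' {l | l ≠ p}) :=
    Submodule.smul_mem _ c
      (actVar_pow_mem_lieSpan hip a (lie_xg_mem_lieSpan hpj.symm hpk.symm))
  have hv_span : v ∈ LieSubalgebra.lieSpan K _ (xg K n '' {l | l ≠ i}) :=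
    actVar_pow_mem_lieSpan hik.symm b
      (actVar_mem_lieSpan hip.symm (lie_xg_mem_lieSpan hip.symm hik.symm))
  have hBu (f : FreeMetabelianLie K n)
      (hf : f ∈ LieAlgebra.derivedSeries K (FreeMetabelianLie K n) 1) :
      transvectionEnd i f u = u := by
    rw [hu, map_smul, hw,
      map_actVar_pow (transvectionEnd_sub_mem i i hf) a (lie_mem_derivedSeries_one _ _),
      LieHom.map_lie, transvectionEnd_of_ne hij.symm, transvectionEnd_of_ne hik.symm]
  set t := (actVar k ^ b) (actVar p (actVar k u)) with ht
  have hAv (f : FreeMetabelianLie K n)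
      (hf : f ∈ LieAlgebra.derivedSeries K (FreeMetabelianLie K n) 1) :
      transvectionEnd p f v = v + (actVar k ^ b) (actVar p (actVar k f)) := by
    rw [hv, map_actVar_pow (transvectionEnd_sub_mem p k hf) b (actVar_mem p z),
      map_actVar (transvectionEnd_sub_mem p p hf) hzN, hz, LieHom.map_lie, transvectionEnd_self,
      transvectionEnd_of_ne hpk.symm, add_lie, map_add, map_add, actVar_apply k f]
  have hAu : transvectionEnd p u u = u := transvectionEnd_of_mem_lieSpan u hu_span
  have hAt : transvectionEnd p u t = t := by
    rw [ht, map_actVar_pow (transvectionEnd_sub_mem p k huN) b (actVar_mem p _),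
      map_actVar (transvectionEnd_sub_mem p p huN) (actVar_mem k u),
      map_actVar (transvectionEnd_sub_mem p k huN) huN, hAu]
  have hBt : transvectionEnd i v t = t := by
    rw [ht, map_actVar_pow (transvectionEnd_sub_mem i k hvN) b (actVar_mem p _),
      map_actVar (transvectionEnd_sub_mem i p hvN) (actVar_mem k u),
      map_actVar (transvectionEnd_sub_mem i k hvN) huN, hBu v hvN]
  have hBv : transvectionEnd i v v = v := transvectionEnd_of_mem_lieSpan v hv_span
  have ht_eq : t = c • (actVar i ^ a) ((actVar k ^ (b + 1)) (actVar p ⁅xg K n j, xg K n k⁆)) := by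
    have hjk := lie_mem_derivedSeries_one (xg K n j) (xg K n k)
    rw [ht, hu, map_smul, map_smul, map_smul, hw, actVar_comm p k hwN, pow_succ,
      Module.End.mul_apply, actVar_pow_pow_comm i k a b (actVar_mem k _),
      actVar_pow_comm i k a (actVar_mem p _), actVar_pow_comm i p a hjk]
  let A := transvection p u hu_span
  let B := transvection i v hv_span
  have hval (x : FreeMetabelianLie K n) : (A * B * A⁻¹ * B⁻¹) x =
      transvectionEnd p u (transvectionEnd i v
        (transvectionEnd p (-u) (transvectionEnd i (-v) x))) := rfl
  refine ⟨A * B * A⁻¹ * B⁻¹, ?_, ?_, fun l hl => ?_⟩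
  · have hA : IsTame K n A := isTame_transvection hu_span
    have hB : IsTame K n B := isTame_transvection hv_span
    exact mul_mem (mul_mem (mul_mem hA hB) (inv_mem hA)) (inv_mem hB)
  · rw [hval, ← ht_eq, transvectionEnd_self, map_add, map_neg,
      transvectionEnd_of_ne hip, hAv (-u) (neg_mem huN), map_neg, map_neg, map_neg, ← ht]
    simp only [map_add, map_neg, transvectionEnd_self, hBv, hBt, hAt,
      transvectionEnd_of_ne hip, hAv u huN, ← ht]
    abel
  · rw [hval, transvectionEnd_of_ne hl]
    by_cases hlp : l = p
    · subst hlp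
      simp only [map_add, map_neg, transvectionEnd_self, transvectionEnd_of_ne hl,
        hBu v hvN, hAu]
      abel
    · rw [transvectionEnd_of_ne hlp, transvectionEnd_of_ne hl, transvectionEnd_of_ne hlp]

theorem actVar_jacobi (i j k : Fin n) :
    actVar k ⁅xg K n i, xg K n j⁆ =
      actVar j ⁅xg K n i, xg K n k⁆ - actVar i ⁅xg K n j, xg K n k⁆ := by
  simp only [actVar_apply]
  rw [lie_lie, ← lie_skew (xg K n j) ⁅xg K n i, xg K n k⁆, ← lie_skew (xg K n i) ⁅xg K n j, xg K n k⁆]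
  abel

theorem polyAct_monomial {γ : K} (hγ : γ ≠ 0) (d : Fin n →₀ ℕ) (m : FreeMetabelianLie K n) :
    polyAct K n (MvPolynomial.monomial d γ) m =
      γ • (List.ofFn fun i => actVar (K := K) i ^ d i).prod m := by
  classical
  rw [polyAct, MvPolynomial.support_monomial, if_neg hγ, Finset.sum_singleton,
    MvPolynomial.coeff_monomial, if_pos rfl]

theorem prod_ofFn_eq_mul_of_ends {M : Type*} [Monoid M] {n : ℕ} (f : Fin (n + 2) → M)
    (hf : ∀ i, i ≠ 0 → i ≠ Fin.last (n + 1) → f i = 1) :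
    (List.ofFn f).prod = f 0 * f (Fin.last (n + 1)) := by
  have h : ∀ i : Fin n, f i.castSucc.succ = 1 := fun i =>
    hf _ (Fin.succ_ne_zero _) fun h => (Fin.castSucc_lt_last i).ne (Fin.succ_injective _ h)
  rw [List.ofFn_succ, List.prod_cons, List.ofFn_succ', List.concat_eq_append, List.prod_append,
    List.prod_singleton]
  simp [h]

theorem polyAct_ends {γ : K} (hγ : γ ≠ 0) (a b : ℕ) {i k : Fin n} (hi : (i : ℕ) = 0)
    (hk : (k : ℕ) = n - 1) (hik : i ≠ k) (m : FreeMetabelianLie K n) :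
    polyAct K n (MvPolynomial.C γ * MvPolynomial.X i ^ a * MvPolynomial.X k ^ b) m =
      γ • (actVar i ^ a) ((actVar k ^ b) m) := by
  have hp : MvPolynomial.C γ * MvPolynomial.X i ^ a * MvPolynomial.X k ^ b =
      MvPolynomial.monomial (Finsupp.single i a + Finsupp.single k b) γ := by
    rw [MvPolynomial.X_pow_eq_monomial, MvPolynomial.X_pow_eq_monomial,
      MvPolynomial.C_mul_monomial, MvPolynomial.monomial_mul, mul_one, mul_one]
  rw [hp, polyAct_monomial hγ]
  have hki : (k : ℕ) ≠ 0 := fun h => hik (Fin.ext (hi.trans h.symm))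
  obtain ⟨N, rfl⟩ : ∃ N, n = N + 2 := ⟨n - 2, by have := k.2; omega⟩
  obtain rfl : i = 0 := Fin.ext hi
  obtain rfl : k = Fin.last (N + 1) := Fin.ext hk
  rw [prod_ofFn_eq_mul_of_ends]
  · simp [hik, hik.symm]
  · intro l hl0 hlN
    simp [hl0.symm, hlN.symm]

end FreeMetabelianLie

open MvPolynomial in
/-- **Case 2 of Theorem 1 (`iₙ ≥ 2`).** Over any field `K`, for `n ≥ 4`, `0 ≠ γ ∈ K`,
`i₁ ≥ 1` and `iₙ ≥ 2`, the Chein automorphism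
`C(γ y₁^{i₁} yₙ^{iₙ}) = (x₁ + [x₂,x₃] γ y₁^{i₁} yₙ^{iₙ}, x₂, …, xₙ)` of `Mₙ` is tame. -/
theorem chein_monomial_y1_yn_is_tame (K : Type) [Field K] (n : ℕ) (hn : 4 ≤ n)
    (γ : K) (hγ : γ ≠ 0) (e1 en : ℕ) (he1 : 1 ≤ e1) (hen : 2 ≤ en)
    (i0 i1 i2 iN : Fin n)
    (h0 : (i0 : ℕ) = 0) (h1 : (i1 : ℕ) = 1) (h2 : (i2 : ℕ) = 2) (hN : (iN : ℕ) = n - 1)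
    (φ : FreeMetabelianLie K n ≃ₗ⁅K⁆ FreeMetabelianLie K n)
    (hφ0 : φ (xg K n i0) = xg K n i0 +
      polyAct K n (C γ * X i0 ^ e1 * X iN ^ en) ⁅xg K n i1, xg K n i2⁆)
    (hφ : ∀ j : Fin n, j ≠ i0 → φ (xg K n j) = xg K n j) :
    IsTame K n φ := by
  have h01 : i0 ≠ i1 := fun h => by omega
  have h02 : i0 ≠ i2 := fun h => by omega
  have h0N : i0 ≠ iN := fun h => by omega
  have h12 : i1 ≠ i2 := fun h => by omega
  have h1N : i1 ≠ iN := fun h => by omega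
  have h2N : i2 ≠ iN := fun h => by omega
  obtain ⟨b, rfl⟩ := Nat.exists_eq_add_of_le' hen
  obtain ⟨ψ₁, hψ₁, hψ₁i, hψ₁j⟩ :=
    FreeMetabelianLie.exists_isTame_chein h02 h01 h0N h12.symm h2N γ e1 b
  obtain ⟨ψ₂, hψ₂, hψ₂i, hψ₂j⟩ :=
    FreeMetabelianLie.exists_isTame_chein h01 h02 h0N h12 h1N (-γ) e1 b
  have hψ₁N (l : Fin n) : ψ₁.toLieHom (xg K n l) - xg K n l ∈
      LieAlgebra.derivedSeries K (FreeMetabelianLie K n) 1 := by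
    change ψ₁ (xg K n l) - xg K n l ∈ _
    by_cases hl : l = i0
    · subst hl
      rw [hψ₁i, add_sub_cancel_left]
      exact Submodule.smul_mem _ _ (FreeMetabelianLie.actVar_pow_mem _ _
        (FreeMetabelianLie.actVar_pow_mem _ _ (FreeMetabelianLie.actVar_mem _ _)))
    · rw [hψ₁j l hl, sub_self]
      exact zero_mem _
  have hψ₁m : ψ₁.toLieHom ((FreeMetabelianLie.actVar i0 ^ e1)
      ((FreeMetabelianLie.actVar iN ^ (b + 1))
        (FreeMetabelianLie.actVar i1 ⁅xg K n i2, xg K n iN⁆))) =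
      (FreeMetabelianLie.actVar i0 ^ e1) ((FreeMetabelianLie.actVar iN ^ (b + 1))
        (FreeMetabelianLie.actVar i1 ⁅xg K n i2, xg K n iN⁆)) := by
    have h2 : ψ₁.toLieHom (xg K n i2) = xg K n i2 := hψ₁j i2 h02.symm
    have hN : ψ₁.toLieHom (xg K n iN) = xg K n iN := hψ₁j iN h0N.symm
    rw [FreeMetabelianLie.map_actVar_pow (hψ₁N i0) _ (FreeMetabelianLie.actVar_pow_mem _ _
        (FreeMetabelianLie.actVar_mem _ _)),
      FreeMetabelianLie.map_actVar_pow (hψ₁N iN) _ (FreeMetabelianLie.actVar_mem _ _),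
      FreeMetabelianLie.map_actVar (hψ₁N i1)
        (FreeMetabelianLie.lie_mem_derivedSeries_one _ _), LieHom.map_lie, h2, hN]
  have hφψ : φ = ψ₁ * ψ₂ := by
    refine FreeMetabelianLie.equiv_ext fun l => ?_
    change φ (xg K n l) = ψ₁.toLieHom (ψ₂ (xg K n l))
    by_cases hl : l = i0
    · subst hl
      have h : ψ₁.toLieHom (xg K n l) = _ := hψ₁i
      rw [hφ0, hψ₂i, map_add, map_smul, hψ₁m, h,
        FreeMetabelianLie.polyAct_ends hγ _ _ h0 hN h0N, pow_succ _ (b + 1),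
        Module.End.mul_apply, FreeMetabelianLie.actVar_jacobi, map_sub, map_sub, smul_sub,
        neg_smul, sub_eq_add_neg, add_assoc]
    · rw [hφ l hl, hψ₂j l hl]
      exact (hψ₁j l hl).symm
  rw [hφψ]
  exact mul_mem hψ₁ hψ₂
end

section
/- Let $K$ be a field, $n\geq 4$, $\lambda\in K$, and $h,g\in U=K[y_1,\ldots,y_n]$. Let $\alpha=(x_1-\lambda x_2,\ x_2,\ldots,x_n)$ and $A(h,g)=(x_1+[x_1,x_n]hg+[x_2,x_n]hg^2,\ x_2-[x_1,x_n]h-[x_2,x_n]hg,\ x_3,\ldots,x_n)$. Then the conjugate $A(h,g)^{\alpha}:=\alpha A(h,g)\alpha^{-1}$ equals $A(h^{\alpha},\ g^{\alpha}-\lambda)$, where for $u\in U$, $u^{\alpha}$ denotes the image of $u$ under the $K$-algebra endomorphism of $U$ induced by $\alpha$ (i.e., $y_1\mapsto y_1-\lambda y_2$ and $y_i\mapsto y_i$ for $i\geq 2$). -/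
/-- The quotient map from the free Lie algebra onto the free metabelian Lie algebra. -/
noncomputable def FreeMetabelianLie.mkHom_s19 (K : Type) [Field K] (n : ℕ) :
    FreeLieAlgebra K (Fin n) →ₗ⁅K⁆ FreeMetabelianLie K n :=
  { (LieSubmodule.Quotient.mk'
      (LieAlgebra.derivedSeries K (FreeLieAlgebra K (Fin n)) 2)).toLinearMap with
    map_lie' := rfl }

theorem FreeMetabelianLie.mkHom_surjective_s19 (K : Type) [Field K] (n : ℕ) :
    Function.Surjective (FreeMetabelianLie.mkHom_s19 K n) :=
  LieSubmodule.Quotient.surjective_mk' _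

/-- Automorphisms of the free metabelian Lie algebra agreeing on the generators are equal. -/
theorem FreeMetabelianLie.equiv_ext_s19 {K : Type} [Field K] {n : ℕ}
    {φ ψ : FreeMetabelianLie K n ≃ₗ⁅K⁆ FreeMetabelianLie K n}
    (h : ∀ i, φ (xg K n i) = ψ (xg K n i)) : φ = ψ := by
  have hcomp : φ.toLieHom.comp (mkHom_s19 K n) = ψ.toLieHom.comp (mkHom_s19 K n) :=
    FreeLieAlgebra.hom_ext h
  refine LieEquiv.ext fun x => ?_
  obtain ⟨y, rfl⟩ := mkHom_surjective_s19 K n x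
  exact LieHom.congr_fun hcomp y

/-- The derived ideal of the free metabelian Lie algebra is abelian. -/
theorem FreeMetabelianLie.lie_eq_zero_s19 {K : Type} [Field K] {n : ℕ} {a b : FreeMetabelianLie K n}
    (ha : a ∈ LieAlgebra.derivedSeries K (FreeMetabelianLie K n) 1)
    (hb : b ∈ LieAlgebra.derivedSeries K (FreeMetabelianLie K n) 1) : ⁅a, b⁆ = 0 := by
  have hbot : LieAlgebra.derivedSeries K (FreeMetabelianLie K n) 2 = ⊥ := by
    rw [← LieIdeal.derivedSeries_map_eq 2 (mkHom_surjective_s19 K n), LieIdeal.map_eq_bot_iff]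
    intro x hx
    exact LieHom.mem_ker.mpr ((LieSubmodule.Quotient.mk_eq_zero _).mpr hx)
  have hab : ⁅a, b⁆ ∈ LieAlgebra.derivedSeries K (FreeMetabelianLie K n) 2 :=
    LieSubmodule.lie_mem_lie ha hb
  rwa [hbot, LieSubmodule.mem_bot] at hab

theorem FreeMetabelianLie.lie_mem_derivedSeries {K : Type} [Field K] {n : ℕ}
    (a b : FreeMetabelianLie K n) :
    ⁅a, b⁆ ∈ LieAlgebra.derivedSeries K (FreeMetabelianLie K n) 1 :=
  LieSubmodule.lie_mem_lie (LieSubmodule.mem_top a) (LieSubmodule.mem_top b)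

theorem List.prod_ofFn_pow_succ_of_commute {M : Type*} [Monoid M] {n : ℕ} (f : Fin n → M)
    (hf : ∀ i j, Commute (f i) (f j)) (d e : Fin n → ℕ) (i : Fin n)
    (hi : e i = d i + 1) (he : ∀ j, j ≠ i → e j = d j) :
    (List.ofFn fun j => f j ^ e j).prod = f i * (List.ofFn fun j => f j ^ d j).prod := by
  induction n with
  | zero => exact i.elim0
  | succ n ih =>
    rw [List.ofFn_succ, List.ofFn_succ, List.prod_cons, List.prod_cons]
    cases i using Fin.cases with
    | zero =>
      rw [hi, pow_succ', mul_assoc]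
      congr! 4 with j
      funext j
      rw [he _ (Fin.succ_ne_zero j)]
    | succ i =>
      rw [he 0 (Fin.succ_ne_zero i).symm,
        ih (fun j => f j.succ) (fun _ _ => hf _ _) (fun j => d j.succ) (fun j => e j.succ) i hi
          fun j hj => he _ fun h => hj (Fin.succ_injective _ h),
        ← mul_assoc, ← mul_assoc, ((hf 0 i.succ).pow_left _).eq]

theorem Submodule.coe_prod_ofFn_restrict_pow {R M : Type*} [CommRing R] [AddCommGroup M]
    [Module R M] (D : Submodule R M) {n : ℕ} (f : Fin n → Module.End R M)
    (hf : ∀ i, ∀ x ∈ D, f i x ∈ D) (d : Fin n → ℕ) (m : D) :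
    ((List.ofFn fun i => (f i).restrict (hf i) ^ d i).prod m : M) =
      (List.ofFn fun i => f i ^ d i).prod (m : M) := by
  induction n with
  | zero => simp
  | succ n ih =>
    simp only [List.ofFn_succ, List.prod_cons, Module.End.mul_apply]
    rw [← ih (fun i => f i.succ) (fun i => hf i.succ), Module.End.pow_restrict,
      LinearMap.coe_restrict_apply]

theorem polyAct_eq_sum (K : Type) [Field K] (n : ℕ) (a : MvPolynomial (Fin n) K)
    (m : FreeMetabelianLie K n) :
    polyAct K n a m = (MvPolynomial.basisMonomials (Fin n) K).constr K (fun d =>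
      (List.ofFn fun i : Fin n =>
        (-(LieAlgebra.ad K (FreeMetabelianLie K n) (xg K n i))) ^ (d i)).prod m) a := by
  rw [Module.Basis.constr_apply]
  rfl

theorem polyAct_add_left (K : Type) [Field K] (n : ℕ) (a b : MvPolynomial (Fin n) K)
    (m : FreeMetabelianLie K n) : polyAct K n (a + b) m = polyAct K n a m + polyAct K n b m := by
  simp only [polyAct_eq_sum, map_add]

theorem polyAct_sub_left (K : Type) [Field K] (n : ℕ) (a b : MvPolynomial (Fin n) K)
    (m : FreeMetabelianLie K n) : polyAct K n (a - b) m = polyAct K n a m - polyAct K n b m := by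
  simp only [polyAct_eq_sum, map_sub]

theorem polyAct_smul_left (K : Type) [Field K] (n : ℕ) (c : K) (a : MvPolynomial (Fin n) K)
    (m : FreeMetabelianLie K n) : polyAct K n (c • a) m = c • polyAct K n a m := by
  simp only [polyAct_eq_sum, map_smul]

theorem polyAct_sub_right (K : Type) [Field K] (n : ℕ) (a : MvPolynomial (Fin n) K)
    (m m' : FreeMetabelianLie K n) :
    polyAct K n a (m - m') = polyAct K n a m - polyAct K n a m' := by
  simp only [polyAct, map_sub, smul_sub, Finset.sum_sub_distrib]

theorem polyAct_smul_right (K : Type) [Field K] (n : ℕ) (a : MvPolynomial (Fin n) K) (c : K)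
    (m : FreeMetabelianLie K n) : polyAct K n a (c • m) = c • polyAct K n a m := by
  simp only [polyAct, map_smul, Finset.smul_sum, smul_comm c]

theorem polyAct_monomial (K : Type) [Field K] (n : ℕ) (d : Fin n →₀ ℕ) (c : K)
    (m : FreeMetabelianLie K n) :
    polyAct K n (MvPolynomial.monomial d c) m = c • (List.ofFn fun i : Fin n =>
      (-(LieAlgebra.ad K (FreeMetabelianLie K n) (xg K n i))) ^ (d i)).prod m := by
  have h : MvPolynomial.monomial d c = c • MvPolynomial.basisMonomials (Fin n) K d := by
    simp [MvPolynomial.smul_monomial]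
  rw [polyAct_eq_sum, h, map_smul, Module.Basis.constr_basis]

theorem polyAct_C (K : Type) [Field K] (n : ℕ) (c : K) (m : FreeMetabelianLie K n) :
    polyAct K n (MvPolynomial.C c) m = c • m := by
  rw [← MvPolynomial.monomial_zero', polyAct_monomial]
  simp

/-- On the derived ideal, multiplication by `yᵢ` acts as bracketing with `xᵢ` on the right. -/
theorem polyAct_mul_X {K : Type} [Field K] {n : ℕ} (a : MvPolynomial (Fin n) K) (i : Fin n)
    {m : FreeMetabelianLie K n}
    (hm : m ∈ LieAlgebra.derivedSeries K (FreeMetabelianLie K n) 1) :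
    polyAct K n (a * MvPolynomial.X i) m = ⁅polyAct K n a m, xg K n i⁆ := by
  induction a using MvPolynomial.induction_on' with
  | add p q hp hq => rw [add_mul, polyAct_add_left, polyAct_add_left, hp, hq, add_lie]
  | monomial d c =>
    let D := (LieAlgebra.derivedSeries K (FreeMetabelianLie K n) 1).toSubmodule
    let f : Fin n → Module.End K (FreeMetabelianLie K n) := fun j =>
      -(LieAlgebra.ad K (FreeMetabelianLie K n) (xg K n j))
    have hf : ∀ j, ∀ x ∈ D, f j x ∈ D := fun j x hx =>
      D.neg_mem (lie_mem_right K _ (LieAlgebra.derivedSeries K _ 1) (xg K n j) x hx)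
    have hcomm : ∀ j k, Commute ((f j).restrict (hf j)) ((f k).restrict (hf k)) := by
      intro j k
      refine LinearMap.ext fun x => Subtype.ext ?_
      have hjk := FreeMetabelianLie.lie_eq_zero_s19
        (FreeMetabelianLie.lie_mem_derivedSeries (xg K n j) (xg K n k)) x.2
      rw [lie_lie, sub_eq_zero] at hjk
      change -⁅xg K n j, -⁅xg K n k, (x : FreeMetabelianLie K n)⁆⁆ =
        -⁅xg K n k, -⁅xg K n j, (x : FreeMetabelianLie K n)⁆⁆
      rw [lie_neg, lie_neg, neg_neg, neg_neg, hjk]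
    have key := congrArg (fun g => ((g ⟨m, hm⟩ : D) : FreeMetabelianLie K n))
      (List.prod_ofFn_pow_succ_of_commute _ hcomm d (d + Finsupp.single i 1 : Fin n →₀ ℕ) i
        (by simp) fun j hj => by simp [hj])
    simp only [Module.End.mul_apply, LinearMap.coe_restrict_apply,
      Submodule.coe_prod_ofFn_restrict_pow] at key
    rw [MvPolynomial.X, MvPolynomial.monomial_mul, mul_one, polyAct_monomial, polyAct_monomial,
      smul_lie]
    refine congrArg (c • ·) (key.trans ?_)
    rw [← lie_skew]
    rfl

/-- If bracketing with `φ xᵢ` acts on the derived ideal as multiplication by `s i`, then `φ` is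
semilinear on the derived ideal along the substitution `yᵢ ↦ s i`. -/
theorem map_polyAct {K : Type} [Field K] {n : ℕ}
    (φ : FreeMetabelianLie K n →ₗ⁅K⁆ FreeMetabelianLie K n) (s : Fin n → MvPolynomial (Fin n) K)
    (hs : ∀ i, ∀ m ∈ LieAlgebra.derivedSeries K (FreeMetabelianLie K n) 1, ∀ a,
      polyAct K n (a * s i) m = ⁅polyAct K n a m, φ (xg K n i)⁆)
    (a : MvPolynomial (Fin n) K) {m : FreeMetabelianLie K n}
    (hm : m ∈ LieAlgebra.derivedSeries K (FreeMetabelianLie K n) 1) :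
    φ (polyAct K n a m) = polyAct K n (MvPolynomial.aeval s a) (φ m) := by
  have hφm : φ m ∈ LieAlgebra.derivedSeries K (FreeMetabelianLie K n) 1 :=
    LieIdeal.derivedSeries_map_le 1 (LieIdeal.mem_map (f := φ) hm)
  induction a using MvPolynomial.induction_on with
  | C c => rw [polyAct_C, MvPolynomial.aeval_C, MvPolynomial.algebraMap_eq, polyAct_C, map_smul]
  | add p q hp hq => rw [polyAct_add_left, map_add, map_add, polyAct_add_left, hp, hq]
  | mul_X p i hp =>
    rw [polyAct_mul_X _ _ hm, LieHom.map_lie, hp, map_mul, MvPolynomial.aeval_X, hs i _ hφm]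

open MvPolynomial in
/-- **Conjugation identity (step (a) in Lemma 7).** For `α = (x₁ - λx₂, x₂, …, xₙ)` and
`A(h,g) = (x₁ + [x₁,xₙ]hg + [x₂,xₙ]hg², x₂ - [x₁,xₙ]h - [x₂,xₙ]hg, x₃, …, xₙ)`, one has
`A(h,g)^α = α A(h,g) α⁻¹ = A(h^α, g^α - λ)`, where `u ↦ u^α` is the `K`-algebra
endomorphism of `U` with `y₁ ↦ y₁ - λy₂` and `yᵢ ↦ yᵢ` for `i ≥ 2`. -/
theorem conj_A_h_g (K : Type) [Field K] (n : ℕ) (hn : 4 ≤ n)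
    (lam : K) (h g : MvPolynomial (Fin n) K)
    (i0 i1 iN : Fin n) (h0 : (i0 : ℕ) = 0) (h1 : (i1 : ℕ) = 1) (hN : (iN : ℕ) = n - 1)
    (α A χ : FreeMetabelianLie K n ≃ₗ⁅K⁆ FreeMetabelianLie K n)
    (hα0 : α (xg K n i0) = xg K n i0 - lam • xg K n i1)
    (hα : ∀ j : Fin n, j ≠ i0 → α (xg K n j) = xg K n j)
    (hA0 : A (xg K n i0) = xg K n i0 + polyAct K n (h * g) ⁅xg K n i0, xg K n iN⁆
      + polyAct K n (h * g ^ 2) ⁅xg K n i1, xg K n iN⁆)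
    (hA1 : A (xg K n i1) = xg K n i1 - polyAct K n h ⁅xg K n i0, xg K n iN⁆
      - polyAct K n (h * g) ⁅xg K n i1, xg K n iN⁆)
    (hA : ∀ j : Fin n, j ≠ i0 → j ≠ i1 → A (xg K n j) = xg K n j)
    (hχ0 : χ (xg K n i0) = xg K n i0
      + polyAct K n
          ((aeval fun i => if i = i0 then X i0 - MvPolynomial.C lam * X i1 else X i) h *
           ((aeval fun i => if i = i0 then X i0 - MvPolynomial.C lam * X i1 else X i) g -
             MvPolynomial.C lam))
          ⁅xg K n i0, xg K n iN⁆
      + polyAct K n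
          ((aeval fun i => if i = i0 then X i0 - MvPolynomial.C lam * X i1 else X i) h *
           ((aeval fun i => if i = i0 then X i0 - MvPolynomial.C lam * X i1 else X i) g -
             MvPolynomial.C lam) ^ 2)
          ⁅xg K n i1, xg K n iN⁆)
    (hχ1 : χ (xg K n i1) = xg K n i1
      - polyAct K n
          ((aeval fun i => if i = i0 then X i0 - MvPolynomial.C lam * X i1 else X i) h)
          ⁅xg K n i0, xg K n iN⁆
      - polyAct K n
          ((aeval fun i => if i = i0 then X i0 - MvPolynomial.C lam * X i1 else X i) h *
           ((aeval fun i => if i = i0 then X i0 - MvPolynomial.C lam * X i1 else X i) g -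
             MvPolynomial.C lam))
          ⁅xg K n i1, xg K n iN⁆)
    (hχ : ∀ j : Fin n, j ≠ i0 → j ≠ i1 → χ (xg K n j) = xg K n j) :
    α * A * α⁻¹ = χ := by
  have hi10 : i1 ≠ i0 := fun h => by rw [h] at h1; omega
  have hN0 : iN ≠ i0 := fun h => by rw [h] at hN; omega
  set s : Fin n → MvPolynomial (Fin n) K :=
    fun i => if i = i0 then X i0 - MvPolynomial.C lam * X i1 else X i with hs
  have hact : ∀ (a : MvPolynomial (Fin n) K) (u v : FreeMetabelianLie K n),
      α (polyAct K n a ⁅u, v⁆) = polyAct K n (aeval s a) ⁅α u, α v⁆ := by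
    intro a u v
    rw [← LieEquiv.map_lie]
    refine map_polyAct α.toLieHom s (fun i m hm a => ?_) a
      (FreeMetabelianLie.lie_mem_derivedSeries u v)
    change _ = ⁅_, α (xg K n i)⁆
    by_cases hi : i = i0
    · have ha : a * s i = a * X i0 - lam • (a * X i1) := by
        rw [hs, MvPolynomial.smul_eq_C_mul]
        simp only [hi, if_true]
        ring
      rw [ha, hi, hα0, polyAct_sub_left, polyAct_smul_left, polyAct_mul_X _ _ hm,
        polyAct_mul_X _ _ hm, lie_sub, lie_smul]
    · rw [hα i hi, ← polyAct_mul_X _ _ hm, hs]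
      simp only [hi, if_false]
  rw [mul_inv_eq_iff_eq_mul]
  refine FreeMetabelianLie.equiv_ext_s19 fun i => ?_
  change α (A (xg K n i)) = χ (α (xg K n i))
  have hC : ∀ a m, polyAct K n (a * MvPolynomial.C lam) m = lam • polyAct K n a m :=
    fun a m => by rw [mul_comm, ← MvPolynomial.smul_eq_C_mul, polyAct_smul_left]
  have hsq : ∀ p q : MvPolynomial (Fin n) K, p * (q - MvPolynomial.C lam) ^ 2 =
      p * q ^ 2 - p * q * MvPolynomial.C lam - p * q * MvPolynomial.C lam
        + p * MvPolynomial.C lam * MvPolynomial.C lam := fun p q => by ring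
  by_cases hi0 : i = i0
  · subst hi0
    rw [hA0, hα0]
    simp only [map_add, map_sub, map_smul, hact, sub_lie, smul_lie, hα0, hα i1 hi10, hα iN hN0,
      hχ0, hχ1, map_mul, map_pow, mul_sub, hsq, polyAct_add_left, polyAct_sub_left, polyAct_sub_right,
      polyAct_smul_right, hC]
    module
  · by_cases hi1 : i = i1
    · subst hi1
      rw [hA1, hα i hi0]
      simp only [map_sub, hact, sub_lie, smul_lie, hα0, hα i hi0, hα iN hN0, hχ1,
        map_mul, mul_sub, polyAct_sub_left, polyAct_sub_right, polyAct_smul_right, hC]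
      module
    · rw [hA i hi0 hi1, hα i hi0, hχ i hi0 hi1]
end
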